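/- Let θ ∈ (0, π/2) and take β = 1, so K = (2 − 2 cos θ)/sin² θ = 2/(1 + cos θ). Then 1 − cos² θ·K = (1 + 2 cos θ)(1 − cos θ)/(1 + cos θ), and at the critical density (1 − n^{−2/d} = cos² θ with n = (1/sin θ)^d) the Theorem-2 query and update exponents are equal, with common value ρ_q = ρ_u = log((1 + cos θ)²/(1 + 2 cos θ))/(2 log(1/sin θ)); moreover this value equals (2·log(tan(θ/2)) + log(2 cos θ + 1))/(2·log(sin θ)) − 1. -/

import Mathlib

open Real

/-- The half-angle formula for the tangent, for angles strictly between `-π` and `π`. -/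
theorem tan_half_eq_sin_div_one_add_cos {θ : ℝ} (h₁ : -π < θ) (h₂ : θ < π) :
    Real.tan (θ / 2) = Real.sin θ / (1 + Real.cos θ) := by
  have hc : 0 < Real.cos (θ / 2) := Real.cos_pos_of_mem_Ioo ⟨by linarith, by linarith⟩
  have hsin : Real.sin θ = 2 * Real.sin (θ / 2) * Real.cos (θ / 2) := by
    rw [← Real.sin_two_mul, mul_div_cancel₀ θ two_ne_zero]
  have hcos : Real.cos θ = 2 * Real.cos (θ / 2) ^ 2 - 1 := by
    rw [← Real.cos_two_mul, mul_div_cancel₀ θ two_ne_zero]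
  rw [hsin, hcos, Real.tan_eq_sin_div_cos, add_sub_cancel]
  field_simp

theorem stmt_19 (θ : ℝ) (hθ : θ ∈ Set.Ioo 0 (π / 2)) :
    let β : ℝ := 1
    let K : ℝ := (1 + β ^ 2 - 2 * β * Real.cos θ) / Real.sin θ ^ 2
    K = (2 - 2 * Real.cos θ) / Real.sin θ ^ 2 ∧
    K = 2 / (1 + Real.cos θ) ∧
    1 - Real.cos θ ^ 2 * K = (1 + 2 * Real.cos θ) * (1 - Real.cos θ) / (1 + Real.cos θ) ∧
    (-Real.log (1 - Real.cos θ ^ 2 * K) + Real.log (1 - Real.cos θ ^ 2 * β ^ 2))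
        / (2 * Real.log (1 / Real.sin θ))
      = -Real.log (1 - Real.cos θ ^ 2 * K) / (2 * Real.log (1 / Real.sin θ)) - 1 ∧
    (-Real.log (1 - Real.cos θ ^ 2 * K) + Real.log (1 - Real.cos θ ^ 2 * β ^ 2))
        / (2 * Real.log (1 / Real.sin θ))
      = Real.log ((1 + Real.cos θ) ^ 2 / (1 + 2 * Real.cos θ))
        / (2 * Real.log (1 / Real.sin θ)) ∧
    Real.log ((1 + Real.cos θ) ^ 2 / (1 + 2 * Real.cos θ)) / (2 * Real.log (1 / Real.sin θ))
      = (2 * Real.log (Real.tan (θ / 2)) + Real.log (2 * Real.cos θ + 1))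
        / (2 * Real.log (Real.sin θ)) - 1 := by
  intro β K
  obtain ⟨h0, h1⟩ := hθ
  have hc : 0 < Real.cos θ := Real.cos_pos_of_mem_Ioo ⟨by linarith, h1⟩
  have hs : 0 < Real.sin θ := Real.sin_pos_of_pos_of_lt_pi h0 (by linarith)
  have hsq : Real.sin θ ^ 2 = (1 - Real.cos θ) * (1 + Real.cos θ) := by
    rw [Real.sin_sq]; ring
  have hadd : 0 < 1 + Real.cos θ := by linarith
  have hsub : 0 < 1 - Real.cos θ :=
    pos_of_mul_pos_left (hsq ▸ pow_pos hs 2) hadd.le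
  have hs1 : Real.sin θ < 1 := by nlinarith
  have hlog : Real.log (Real.sin θ) ≠ 0 := (Real.log_neg hs hs1).ne
  have hK : K = 2 / (1 + Real.cos θ) := by
    simp only [K, β]
    rw [hsq]
    field_simp
    ring
  have hprod : 1 - Real.cos θ ^ 2 * K
      = (1 + 2 * Real.cos θ) * (1 - Real.cos θ) / (1 + Real.cos θ) := by
    rw [hK]
    field_simp
    ring
  have hlogsq : 2 * Real.log (Real.sin θ)
      = Real.log (1 - Real.cos θ) + Real.log (1 + Real.cos θ) := by
    rw [← Real.log_mul hsub.ne' hadd.ne', ← hsq, Real.log_pow, Nat.cast_ofNat]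
  have hlogprod : Real.log (1 - Real.cos θ ^ 2 * K) = Real.log (1 + 2 * Real.cos θ)
      + 2 * Real.log (Real.sin θ) - 2 * Real.log (1 + Real.cos θ) := by
    rw [hprod, Real.log_div (by positivity) hadd.ne', Real.log_mul (by positivity) hsub.ne']
    linarith
  have hlogβ : Real.log (1 - Real.cos θ ^ 2 * β ^ 2) = 2 * Real.log (Real.sin θ) := by
    simp only [β]
    rw [one_pow, mul_one, ← Real.sin_sq, Real.log_pow, Nat.cast_ofNat]
  have hlogquot : Real.log ((1 + Real.cos θ) ^ 2 / (1 + 2 * Real.cos θ))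
      = 2 * Real.log (1 + Real.cos θ) - Real.log (1 + 2 * Real.cos θ) := by
    rw [Real.log_div (by positivity) (by positivity), Real.log_pow, Nat.cast_ofNat]
  have hlogtan : Real.log (Real.tan (θ / 2))
      = Real.log (Real.sin θ) - Real.log (1 + Real.cos θ) := by
    rw [tan_half_eq_sin_div_one_add_cos (by linarith) (by linarith),
      Real.log_div hs.ne' hadd.ne']
  rw [hlogprod, hlogβ, hlogquot, hlogtan, one_div, Real.log_inv,
    add_comm (2 * Real.cos θ) 1]
  refine ⟨?_, hK, hprod, ?_, ?_, ?_⟩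
  · simp only [K, β]
    ring
  · field_simp
    ring
  · ring
  · field_simp
    ring
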